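/- There exists a universal constant c > 0 such that the following holds. Let n, N ≥ 1 be integers, let δ, ε ∈ (0,1], and let C : {±1}^n → {±1}^N. Suppose that for every i ∈ [n] there is a family M_i of pairwise disjoint 2-element subsets of [N] with |M_i| ≥ δεN/4, and for every Q = {j,k} ∈ M_i a sign a_{i,Q} ∈ {±1}, such that 2^{-n}·∑_{x ∈ {±1}^n} a_{i,Q} · x_i · C(x)_j · C(x)_k ≥ ε/4. Then N ≥ 2^{c·δ²·ε⁴·n}. -/

import Mathlib

/-- Interpret a Boolean as an element of `{±1} ⊆ ℝ`. -/
def pmOne (b : Bool) : ℝ := if b then 1 else -1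

open Matrix

theorem pmOne_mul_self (b : Bool) : pmOne b * pmOne b = 1 := by
  cases b <;> simp [pmOne]

theorem pmOne_not (b : Bool) : pmOne (!b) = -pmOne b := by
  cases b <;> simp [pmOne]

section Spectral

variable {ι : Type*} [Fintype ι] [DecidableEq ι]

/-- All powers of a real symmetric matrix are simultaneously orthogonally diagonalizable. -/
theorem Matrix.IsSymm.exists_orthogonal_pow_eq {X : Matrix ι ι ℝ} (hX : X.IsSymm) :
    ∃ (U : Matrix ι ι ℝ) (l : ι → ℝ), U * Uᵀ = 1 ∧ Uᵀ * U = 1 ∧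
      ∀ k : ℕ, X ^ k = U * diagonal (fun i => l i ^ k) * Uᵀ := by
  have hH : X.IsHermitian := by
    rw [Matrix.IsHermitian, conjTranspose_eq_transpose_of_trivial]; exact hX
  let U : Matrix ι ι ℝ := hH.eigenvectorUnitary
  have h1 : U * Uᵀ = 1 := by
    have := (Unitary.mem_iff.mp hH.eigenvectorUnitary.2).2
    rwa [star_eq_conjTranspose, conjTranspose_eq_transpose_of_trivial] at this
  have h2 : Uᵀ * U = 1 := by
    have := (Unitary.mem_iff.mp hH.eigenvectorUnitary.2).1
    rwa [star_eq_conjTranspose, conjTranspose_eq_transpose_of_trivial] at this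
  have h3 : X = U * diagonal hH.eigenvalues * Uᵀ := by
    have := hH.spectral_theorem
    rw [Unitary.conjStarAlgAut_apply, star_eq_conjTranspose,
      conjTranspose_eq_transpose_of_trivial] at this
    exact this
  refine ⟨U, hH.eigenvalues, h1, h2, fun k => ?_⟩
  induction k with
  | zero => simp [h1]
  | succ k ih =>
    calc X ^ (k + 1) = (U * diagonal (fun i => hH.eigenvalues i ^ k) * Uᵀ) *
          (U * diagonal hH.eigenvalues * Uᵀ) := by rw [pow_succ, ih, ← h3]
      _ = U * diagonal (fun i => hH.eigenvalues i ^ k) * (Uᵀ * U) *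
          diagonal hH.eigenvalues * Uᵀ := by simp only [Matrix.mul_assoc]
      _ = _ := by
        rw [h2, Matrix.mul_one, Matrix.mul_assoc U, diagonal_mul_diagonal]
        simp only [pow_succ]

theorem trace_pow_eq_sum {X U : Matrix ι ι ℝ} {l : ι → ℝ} (hU : Uᵀ * U = 1) {k : ℕ}
    (h : X ^ k = U * diagonal (fun i => l i ^ k) * Uᵀ) : (X ^ k).trace = ∑ i, l i ^ k := by
  rw [h, Matrix.trace_mul_comm, ← Matrix.mul_assoc, hU, Matrix.one_mul, trace_diagonal]

theorem trace_mul_mul_mul_eq_sum (A U V : Matrix ι ι ℝ) (hA : A.IsSymm) (d e : ι → ℝ) :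
    (A * (U * diagonal d * Uᵀ) * A * (V * diagonal e * Vᵀ)).trace =
      ∑ j, ∑ i, d i * e j * (Vᵀ * A * U) j i ^ 2 := by
  have hW : Uᵀ * A * V = (Vᵀ * A * U)ᵀ := by
    simp only [transpose_mul, transpose_transpose, hA.eq, Matrix.mul_assoc]
  have : (A * (U * diagonal d * Uᵀ) * A * (V * diagonal e * Vᵀ)).trace =
      ((Vᵀ * A * U) * diagonal d * (Vᵀ * A * U)ᵀ * diagonal e).trace := by
    rw [← hW, ← Matrix.mul_assoc _ (V * diagonal e), Matrix.trace_mul_comm _ Vᵀ]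
    simp only [Matrix.mul_assoc]
  rw [this]
  simp only [Matrix.trace, Matrix.diag, mul_diagonal, Matrix.mul_apply (M := _ * diagonal d),
    transpose_apply, Finset.sum_mul]
  refine Finset.sum_congr rfl fun j _ => Finset.sum_congr rfl fun i _ => by ring

theorem two_mul_sum_pow_mul_pow_le (a b : ℝ) (m : ℕ) :
    2 * ∑ q ∈ Finset.range (2 * m + 1), a ^ q * b ^ (2 * m - q) ≤
      (2 * m + 1) * (a ^ (2 * m) + b ^ (2 * m)) := by
  have hrefl := Finset.sum_range_reflect (fun q => a ^ q * b ^ (2 * m - q)) (2 * m + 1)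
  rw [two_mul]
  nth_rewrite 1 [← hrefl]
  rw [← Finset.sum_add_distrib]
  calc _ ≤ ∑ q ∈ Finset.range (2 * m + 1), (a ^ (2 * m) + b ^ (2 * m)) := by
        refine Finset.sum_le_sum fun q hq => ?_
        obtain ⟨s, hs⟩ : ∃ s, 2 * m = q + s :=
          Nat.exists_eq_add_of_le (by have := Finset.mem_range.mp hq; omega)
        have e1 : 2 * m + 1 - 1 - q = s := by omega
        have e2 : 2 * m - s = q := by omega
        have e3 : 2 * m - q = s := by omega
        have ha : a ^ (2 * m) = |a| ^ q * |a| ^ s := by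
          rw [← pow_add, ← hs, (even_two_mul m).pow_abs]
        have hb : b ^ (2 * m) = |b| ^ q * |b| ^ s := by
          rw [← pow_add, ← hs, (even_two_mul m).pow_abs]
        have h1 : a ^ s * b ^ q ≤ |a| ^ s * |b| ^ q := by
          rw [← abs_pow, ← abs_pow, ← abs_mul]; exact le_abs_self _
        have h2 : a ^ q * b ^ s ≤ |a| ^ q * |b| ^ s := by
          rw [← abs_pow, ← abs_pow, ← abs_mul]; exact le_abs_self _
        have h3 : 0 ≤ (|a| ^ q - |b| ^ q) * (|a| ^ s - |b| ^ s) := by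
          rcases le_total |a| |b| with h | h
          · exact mul_nonneg_of_nonpos_of_nonpos
              (sub_nonpos.mpr (pow_le_pow_left₀ (abs_nonneg _) h q))
              (sub_nonpos.mpr (pow_le_pow_left₀ (abs_nonneg _) h s))
          · exact mul_nonneg
              (sub_nonneg.mpr (pow_le_pow_left₀ (abs_nonneg _) h q))
              (sub_nonneg.mpr (pow_le_pow_left₀ (abs_nonneg _) h s))
        rw [e1, e2, e3, ha, hb]
        nlinarith
    _ = _ := by simp [mul_add]

theorem trace_pow_two_mul_mul_le {A X : Matrix ι ι ℝ} (hX : X.IsSymm) {d : ι → ℝ}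
    (hA : A * A = diagonal d) (hd : ∀ j, d j ≤ 1) (m : ℕ) :
    (A * X ^ (2 * m) * A).trace ≤ (X ^ (2 * m)).trace := by
  rw [Matrix.trace_mul_comm, ← Matrix.mul_assoc, hA]
  simp only [Matrix.trace, Matrix.diag, diagonal_mul]
  refine Finset.sum_le_sum fun j _ => mul_le_of_le_one_left ?_ (hd j)
  have : X ^ (2 * m) = X ^ m * (X ^ m)ᵀ := by
    rw [transpose_pow, hX.eq, ← pow_add, two_mul]
  rw [this, Matrix.mul_apply]
  exact Finset.sum_nonneg fun k _ => mul_self_nonneg _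

theorem two_mul_sum_trace_le {A X Y : Matrix ι ι ℝ} (hAs : A.IsSymm) (hX : X.IsSymm)
    (hY : Y.IsSymm) {d : ι → ℝ} (hA : A * A = diagonal d) (hd : ∀ j, d j ≤ 1) (m : ℕ) :
    2 * ∑ q ∈ Finset.range (2 * m + 1), (A * X ^ q * A * Y ^ (2 * m - q)).trace ≤
      (2 * m + 1) * ((X ^ (2 * m)).trace + (Y ^ (2 * m)).trace) := by
  obtain ⟨U, l, -, -, hU⟩ := hX.exists_orthogonal_pow_eq
  obtain ⟨V, k, -, -, hV⟩ := hY.exists_orthogonal_pow_eq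
  have key (q s : ℕ) := trace_mul_mul_mul_eq_sum A U V hAs (fun i => l i ^ q) (fun i => k i ^ s)
  simp only [← hU, ← hV] at key
  have hXt := trace_pow_two_mul_mul_le hX hA hd m
  have hYt := trace_pow_two_mul_mul_le hY hA hd m
  have kX := key (2 * m) 0
  have kY := key 0 (2 * m)
  rw [pow_zero, Matrix.mul_one] at kX
  rw [pow_zero, Matrix.mul_one, Matrix.mul_assoc, Matrix.trace_mul_comm] at kY
  simp only [pow_zero, mul_one, one_mul] at kX kY
  refine le_trans ?_ (mul_le_mul_of_nonneg_left (add_le_add hXt hYt) (by positivity))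
  rw [kX, kY]
  simp only [key]
  rw [Finset.sum_comm, ← Finset.sum_add_distrib, Finset.mul_sum, Finset.mul_sum]
  refine Finset.sum_le_sum fun j _ => ?_
  rw [Finset.sum_comm, ← Finset.sum_add_distrib, Finset.mul_sum, Finset.mul_sum]
  refine Finset.sum_le_sum fun i _ => ?_
  rw [← Finset.sum_mul, ← add_mul, ← mul_assoc, ← mul_assoc]
  exact mul_le_mul_of_nonneg_right (two_mul_sum_pow_mul_pow_le _ _ _) (sq_nonneg _)

theorem pow_sub_pow_eq_sum_mul_sub_mul {R : Type*} [Ring R] (x y : R) (r : ℕ) :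
    x ^ (r + 1) - y ^ (r + 1) =
      ∑ q ∈ Finset.range (r + 1), x ^ q * (x - y) * y ^ (r - q) := by
  have := Finset.sum_range_sub (fun q => x ^ q * y ^ (r + 1 - q)) (r + 1)
  simp only [Nat.sub_self, pow_zero, mul_one, Nat.sub_zero, one_mul] at this
  rw [← this]
  refine Finset.sum_congr rfl fun q hq => ?_
  have h1 : r + 1 - q = (r - q) + 1 := by have := Finset.mem_range.mp hq; omega
  have h2 : r + 1 - (q + 1) = r - q := by omega
  rw [h1, h2, pow_succ x, pow_succ' y]
  noncomm_ring

theorem trace_mul_pow_sub_pow_le {A X Y : Matrix ι ι ℝ} (hAs : A.IsSymm) (hX : X.IsSymm)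
    (hY : Y.IsSymm) (hXY : X - Y = (2 : ℝ) • A) {d : ι → ℝ} (hA : A * A = diagonal d)
    (hd : ∀ j, d j ≤ 1) (m : ℕ) :
    (A * (X ^ (2 * m + 1) - Y ^ (2 * m + 1))).trace ≤
      (2 * m + 1) * ((X ^ (2 * m)).trace + (Y ^ (2 * m)).trace) := by
  refine le_trans (le_of_eq ?_) (two_mul_sum_trace_le hAs hX hY hA hd m)
  rw [pow_sub_pow_eq_sum_mul_sub_mul, hXY, Matrix.mul_sum, trace_sum, Finset.mul_sum]
  refine Finset.sum_congr rfl fun q _ => ?_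
  simp only [Matrix.mul_smul, Matrix.smul_mul, trace_smul, smul_eq_mul, Matrix.mul_assoc]

theorem dotProduct_mulVec_pow_le {X : Matrix ι ι ℝ} (hX : X.IsSymm) (v : ι → ℝ) {p : ℕ}
    (hp : p ≠ 0) :
    (v ⬝ᵥ X *ᵥ v) ^ (2 * p) ≤ (v ⬝ᵥ v) ^ (2 * p) * (X ^ (2 * p)).trace := by
  rcases isEmpty_or_nonempty ι with hι | hι
  · simp [dotProduct, hp]
  obtain ⟨U, l, hU, hU', h⟩ := hX.exists_orthogonal_pow_eq
  rw [trace_pow_eq_sum hU' (h _)]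
  set w := Uᵀ *ᵥ v with hw
  have hvU : v ᵥ* U = w := by rw [hw, mulVec_transpose]
  have h1 : v ⬝ᵥ X *ᵥ v = ∑ i, l i * w i ^ 2 := by
    have := h 1
    simp only [pow_one] at this
    rw [this, ← mulVec_mulVec, ← mulVec_mulVec, dotProduct_mulVec, hvU]
    simp only [dotProduct, mulVec_diagonal]
    exact Finset.sum_congr rfl fun i _ => by rw [← hw]; ring
  have h2 : v ⬝ᵥ v = ∑ i, w i ^ 2 := by
    calc v ⬝ᵥ v = v ⬝ᵥ (U * Uᵀ) *ᵥ v := by rw [hU, one_mulVec]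
      _ = w ⬝ᵥ w := by rw [← mulVec_mulVec, dotProduct_mulVec, hvU]
      _ = _ := by simp [dotProduct, sq]
  obtain ⟨i₀, -, hi₀⟩ := Finset.exists_max_image Finset.univ (fun i => |l i|) Finset.univ_nonempty
  have h3 : |∑ i, l i * w i ^ 2| ≤ |l i₀| * ∑ i, w i ^ 2 := by
    refine (Finset.abs_sum_le_sum_abs _ _).trans ?_
    rw [Finset.mul_sum]
    refine Finset.sum_le_sum fun i hi => ?_
    rw [abs_mul, abs_of_nonneg (sq_nonneg (w i))]
    exact mul_le_mul_of_nonneg_right (hi₀ i hi) (sq_nonneg _)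
  rw [h1, h2, ← (even_two_mul p).pow_abs]
  refine (pow_le_pow_left₀ (abs_nonneg _) h3 _).trans ?_
  rw [mul_pow, (even_two_mul p).pow_abs, mul_comm]
  refine mul_le_mul_of_nonneg_left ?_ ((even_two_mul p).pow_nonneg (∑ i, w i ^ 2))
  exact Finset.single_le_sum (f := fun i => l i ^ (2 * p))
    (fun i _ => (even_two_mul p).pow_nonneg (l i)) (Finset.mem_univ i₀)

end Spectral

/-- Negating the `i`-th coordinate of a Boolean string. -/
def flipAt {κ : Type*} [DecidableEq κ] (i : κ) (x : κ → Bool) : κ → Bool :=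
  Function.update x i (!x i)

theorem flipAt_involutive {κ : Type*} [DecidableEq κ] (i : κ) : Function.Involutive (flipAt i) := by
  intro x
  simp [flipAt]

section Khintchine

variable {ι κ : Type*} [Fintype κ]

/-- The Rademacher sum `∑ i, x_i A_i`. -/
def signSum (A : κ → Matrix ι ι ℝ) (x : κ → Bool) : Matrix ι ι ℝ := ∑ i, pmOne (x i) • A i

theorem signSum_isSymm {A : κ → Matrix ι ι ℝ} (hA : ∀ i, (A i).IsSymm) (x : κ → Bool) :
    (signSum A x).IsSymm := by
  rw [Matrix.IsSymm, signSum, transpose_sum]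
  exact Finset.sum_congr rfl fun i _ => by rw [transpose_smul, (hA i).eq]

variable [DecidableEq κ]

theorem signSum_sub_flipAt (A : κ → Matrix ι ι ℝ) (i : κ) (x : κ → Bool) :
    signSum A x - signSum A (flipAt i x) = (2 : ℝ) • pmOne (x i) • A i := by
  rw [signSum, signSum, ← Finset.sum_sub_distrib, Finset.sum_eq_single i]
  · simp only [flipAt, Function.update_self, pmOne_not, neg_smul, sub_neg_eq_add, two_smul]
  · intro j _ hj
    simp [flipAt, Function.update_of_ne hj]
  · simp

variable [Fintype ι] [DecidableEq ι]

theorem sum_trace_signSum_pow_succ_le {A : κ → Matrix ι ι ℝ} (hAs : ∀ i, (A i).IsSymm)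
    {d : κ → ι → ℝ} (hA : ∀ i, A i * A i = diagonal (d i)) (hd : ∀ i j, d i j ≤ 1) (m : ℕ) :
    ∑ x, (signSum A x ^ (2 * (m + 1))).trace ≤
      Fintype.card κ * (2 * m + 1) * ∑ x, (signSum A x ^ (2 * m)).trace := by
  set T := ∑ x, (signSum A x ^ (2 * m)).trace with hT
  have hi (i : κ) : ∑ x, (pmOne (x i) • A i * signSum A x ^ (2 * m + 1)).trace ≤
      (2 * m + 1) * T := by
    let f : (κ → Bool) → ℝ := fun x => (pmOne (x i) • A i * signSum A x ^ (2 * m + 1)).trace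
    let g : (κ → Bool) → ℝ := fun x => (signSum A x ^ (2 * m)).trace
    have hf : ∑ x, f (flipAt i x) = ∑ x, f x :=
      Equiv.sum_comp (flipAt_involutive i).toPerm f
    have hg : ∑ x, g (flipAt i x) = ∑ x, g x :=
      Equiv.sum_comp (flipAt_involutive i).toPerm g
    have hfg (x : κ → Bool) : f x + f (flipAt i x) ≤ (2 * m + 1) * (g x + g (flipAt i x)) := by
      have hB : (pmOne (x i) • A i) * (pmOne (x i) • A i) = diagonal (d i) := by
        rw [Matrix.smul_mul, Matrix.mul_smul, smul_smul, pmOne_mul_self, one_smul, hA]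
      have := trace_mul_pow_sub_pow_le ((hAs i).smul (pmOne (x i))) (signSum_isSymm hAs x)
        (signSum_isSymm hAs (flipAt i x)) (signSum_sub_flipAt A i x) hB (hd i) m
      refine le_trans (le_of_eq ?_) this
      simp only [f, flipAt, Function.update_self, pmOne_not]
      rw [Matrix.mul_sub, trace_sub, neg_smul, Matrix.neg_mul, trace_neg, sub_eq_add_neg]
    have hsum := Finset.sum_le_sum fun x (_ : x ∈ Finset.univ) => hfg x
    rw [Finset.sum_add_distrib, hf, ← Finset.mul_sum, Finset.sum_add_distrib, hg] at hsum
    change ∑ x, f x ≤ (2 * m + 1) * ∑ x, g x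
    linarith
  calc ∑ x, (signSum A x ^ (2 * (m + 1))).trace
      = ∑ x, ∑ i, (pmOne (x i) • A i * signSum A x ^ (2 * m + 1)).trace := by
        refine Finset.sum_congr rfl fun x _ => ?_
        rw [← trace_sum, ← Matrix.sum_mul, ← signSum, ← pow_succ', mul_add, mul_one]
    _ = ∑ i, ∑ x, (pmOne (x i) • A i * signSum A x ^ (2 * m + 1)).trace := Finset.sum_comm
    _ ≤ ∑ _i : κ, (2 * m + 1) * T := Finset.sum_le_sum fun i _ => hi i
    _ = _ := by simp [mul_assoc]

/-- A moment form of the noncommutative Khintchine inequality. -/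
theorem sum_trace_signSum_pow_le {A : κ → Matrix ι ι ℝ} (hAs : ∀ i, (A i).IsSymm)
    {d : κ → ι → ℝ} (hA : ∀ i, A i * A i = diagonal (d i)) (hd : ∀ i j, d i j ≤ 1) (p : ℕ) :
    ∑ x, (signSum A x ^ (2 * p)).trace ≤
      (2 * p * Fintype.card κ) ^ p * (2 ^ Fintype.card κ * Fintype.card ι) := by
  have (m : ℕ) (hm : m ≤ p) : ∑ x, (signSum A x ^ (2 * m)).trace ≤
      (2 * p * Fintype.card κ) ^ m * (2 ^ Fintype.card κ * Fintype.card ι) := by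
    induction m with
    | zero => simp
    | succ m ih =>
      refine (sum_trace_signSum_pow_succ_le hAs hA hd m).trans ?_
      have hmp : (2 * m + 1 : ℝ) ≤ 2 * p := by exact_mod_cast (by omega : 2 * m + 1 ≤ 2 * p)
      calc _ ≤ (Fintype.card κ * (2 * m + 1) : ℝ) *
            ((2 * p * Fintype.card κ) ^ m * (2 ^ Fintype.card κ * Fintype.card ι)) :=
            mul_le_mul_of_nonneg_left (ih (by omega)) (by positivity)
        _ ≤ (Fintype.card κ * (2 * p) : ℝ) *
            ((2 * p * Fintype.card κ) ^ m * (2 ^ Fintype.card κ * Fintype.card ι)) := by gcongr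
        _ = _ := by ring
  exact this p le_rfl

/-- A moment bound for the mean of the quadratic forms of Rademacher sums at vectors of squared
norm `Fintype.card ι`. -/
theorem mean_dotProduct_signSum_pow_le {A : κ → Matrix ι ι ℝ} (hAs : ∀ i, (A i).IsSymm)
    {d : κ → ι → ℝ} (hA : ∀ i, A i * A i = diagonal (d i)) (hd : ∀ i j, d i j ≤ 1)
    (v : (κ → Bool) → ι → ℝ) (hv : ∀ x, v x ⬝ᵥ v x = Fintype.card ι) {p : ℕ} (hp : p ≠ 0) :
    ((2 ^ Fintype.card κ)⁻¹ * ∑ x, v x ⬝ᵥ signSum A x *ᵥ v x) ^ (2 * p) ≤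
      (Fintype.card ι : ℝ) ^ (2 * p) * ((2 * p * Fintype.card κ) ^ p * Fintype.card ι) := by
  rw [Finset.mul_sum]
  refine (Real.pow_arith_mean_le_arith_mean_pow_of_even Finset.univ
    (fun _ => ((2 : ℝ) ^ Fintype.card κ)⁻¹) _ (fun _ _ => by positivity) (by simp)
    (even_two_mul p)).trans ?_
  rw [← Finset.mul_sum, inv_mul_le_iff₀ (by positivity)]
  calc _ ≤ ∑ x, (Fintype.card ι : ℝ) ^ (2 * p) * (signSum A x ^ (2 * p)).trace :=
        Finset.sum_le_sum fun x _ => by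
          rw [← hv x]; exact dotProduct_mulVec_pow_le (signSum_isSymm hAs x) _ hp
    _ ≤ (Fintype.card ι : ℝ) ^ (2 * p) *
        ((2 * p * Fintype.card κ) ^ p * (2 ^ Fintype.card κ * Fintype.card ι)) := by
        rw [← Finset.mul_sum]
        exact mul_le_mul_of_nonneg_left (sum_trace_signSum_pow_le hAs hA hd p) (by positivity)
    _ = _ := by ring

end Khintchine

section Matching

variable {ι : Type*} [DecidableEq ι]

/-- The signed adjacency matrix of a set of pairs. -/
def pairMatrix (M : Finset (Finset ι)) (a : Finset ι → ℝ) : Matrix ι ι ℝ :=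
  fun j k => if {j, k} ∈ M then a {j, k} else 0

theorem pairMatrix_isSymm (M : Finset (Finset ι)) (a : Finset ι → ℝ) :
    (pairMatrix M a).IsSymm := by
  ext j k
  simp only [transpose_apply, pairMatrix, Finset.pair_comm]

theorem eq_of_pair_mem {M : Finset (Finset ι)} (h2 : ∀ Q ∈ M, Q.card = 2)
    (hM : ∀ Q ∈ M, ∀ Q' ∈ M, Q ≠ Q' → Disjoint Q Q') {j k l : ι}
    (hj : {k, j} ∈ M) (hl : {k, l} ∈ M) : j = l := by
  have hkj : k ≠ j := by
    rintro rfl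
    simpa using h2 _ hj
  have heq : ({k, j} : Finset ι) = {k, l} := by
    by_contra hne
    exact Finset.disjoint_left.mp (hM _ hj _ hl hne) (by simp) (by simp : k ∈ ({k, l} : Finset ι))
  have : j ∈ ({k, l} : Finset ι) := heq ▸ (by simp)
  simp only [Finset.mem_insert, Finset.mem_singleton] at this
  exact this.resolve_left hkj.symm

variable [Fintype ι]

theorem pairMatrix_mul_self {M : Finset (Finset ι)} (h2 : ∀ Q ∈ M, Q.card = 2)
    (hM : ∀ Q ∈ M, ∀ Q' ∈ M, Q ≠ Q' → Disjoint Q Q') {a : Finset ι → ℝ}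
    (ha : ∀ Q ∈ M, a Q = 1 ∨ a Q = -1) :
    ∃ d : ι → ℝ, pairMatrix M a * pairMatrix M a = diagonal d ∧ ∀ j, d j ≤ 1 := by
  refine ⟨fun j => ∑ k, pairMatrix M a j k * pairMatrix M a j k, ?_, fun j => ?_⟩
  · ext j l
    rw [Matrix.mul_apply, diagonal_apply]
    split_ifs with h
    · subst h
      exact Finset.sum_congr rfl fun k _ => by rw [(pairMatrix_isSymm M a).apply j k]
    · refine Finset.sum_eq_zero fun k _ => ?_
      by_contra hne
      rw [(pairMatrix_isSymm M a).apply k j] at hne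
      simp only [pairMatrix] at hne
      refine h (eq_of_pair_mem h2 hM (k := k) ?_ ?_)
      · by_contra hk; simp [hk] at hne
      · by_contra hk; simp [hk] at hne
  · beta_reduce
    by_cases hj : ∃ k, {j, k} ∈ M
    · obtain ⟨k, hk⟩ := hj
      rw [Finset.sum_eq_single k]
      · simp only [pairMatrix, hk, if_true]
        rcases ha _ hk with h | h <;> simp [h]
      · intro l _ hl
        have : {j, l} ∉ M := fun h => hl (eq_of_pair_mem h2 hM h hk)
        simp [pairMatrix, this]
      · simp
    · push Not at hj
      simp [pairMatrix, hj]

theorem dotProduct_pairMatrix_mulVec {M : Finset (Finset ι)} (h2 : ∀ Q ∈ M, Q.card = 2)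
    (a : Finset ι → ℝ) (v : ι → ℝ) :
    v ⬝ᵥ pairMatrix M a *ᵥ v = 2 * ∑ Q ∈ M, a Q * ∏ j ∈ Q, v j := by
  have h1 : v ⬝ᵥ pairMatrix M a *ᵥ v =
      ∑ jk : ι × ι, ∑ Q ∈ M, if {jk.1, jk.2} = Q then a Q * (v jk.1 * v jk.2) else 0 := by
    rw [Fintype.sum_prod_type]
    simp only [dotProduct, mulVec, Finset.mul_sum, Finset.sum_ite_eq, pairMatrix]
    refine Finset.sum_congr rfl fun j _ => Finset.sum_congr rfl fun k _ => ?_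
    split_ifs <;> ring
  rw [h1, Finset.sum_comm, Finset.mul_sum]
  refine Finset.sum_congr rfl fun Q hQ => ?_
  obtain ⟨s, t, hst, rfl⟩ := Finset.card_eq_two.mp (h2 Q hQ)
  rw [← Finset.sum_filter, Finset.prod_pair hst]
  have : (Finset.univ.filter fun jk : ι × ι => ({jk.1, jk.2} : Finset ι) = {s, t}) =
      {(s, t), (t, s)} := by
    ext ⟨j, k⟩
    simp only [Finset.mem_filter, Finset.mem_univ, true_and, Finset.mem_insert,
      Finset.mem_singleton, Prod.mk.injEq]
    constructor
    · intro h
      have hj : j ∈ ({s, t} : Finset ι) := h ▸ (by simp)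
      have hk : k ∈ ({s, t} : Finset ι) := h ▸ (by simp)
      have hs : s ∈ ({j, k} : Finset ι) := h ▸ (by simp)
      have ht : t ∈ ({j, k} : Finset ι) := h ▸ (by simp)
      simp only [Finset.mem_insert, Finset.mem_singleton] at hj hk hs ht
      grind
    · rintro (⟨rfl, rfl⟩ | ⟨rfl, rfl⟩)
      · rfl
      · exact Finset.pair_comm _ _
  rw [this, Finset.sum_pair (by simp [hst])]
  ring

end Matching

theorem two_rpow_le_of_pow_le {n N : ℕ} (hn : 1 ≤ n) (hN : 2 ≤ N) {t : ℝ}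
    (h : ∀ p : ℕ, p ≠ 0 → (n * N * t) ^ (2 * p) ≤ (N : ℝ) ^ (2 * p) * ((2 * p * n) ^ p * N)) :
    (2 : ℝ) ^ (n * t ^ 2 / 8) ≤ N := by
  have hN0 : (0 : ℝ) < N := by exact_mod_cast (by omega : 0 < N)
  have hn0 : (0 : ℝ) < n := by exact_mod_cast hn
  set y := n * t ^ 2 / 8 with hy
  have hy0 : 0 ≤ y := by positivity
  rcases lt_or_ge y 1 with h1 | h1
  · calc (2 : ℝ) ^ y ≤ 2 ^ (1 : ℝ) := Real.rpow_le_rpow_of_exponent_le (by norm_num) h1.le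
      _ = 2 := Real.rpow_one 2
      _ ≤ N := by exact_mod_cast hN
  · set p := ⌊y⌋₊ with hp
    have hp1 : 1 ≤ p := Nat.one_le_floor_iff y |>.mpr h1
    have hpy : (p : ℝ) ≤ y := Nat.floor_le hy0
    have hyp : y ≤ (2 * p : ℕ) := by
      have h2 : y < p + 1 := Nat.lt_floor_add_one y
      have h3 : (1 : ℝ) ≤ p := by exact_mod_cast hp1
      push_cast
      linarith
    have hp0 : (0 : ℝ) < p := by exact_mod_cast hp1
    have key := h p (by omega)
    rw [mul_right_comm, mul_pow, mul_comm, mul_le_mul_iff_right₀ (by positivity)] at key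
    have h4 : (2 * p * n : ℝ) ^ p * 4 ^ p ≤ (n * t) ^ (2 * p) := by
      rw [← mul_pow, pow_mul]
      refine pow_le_pow_left₀ (by positivity) ?_ p
      have : 8 * p ≤ n * t ^ 2 := by linarith
      nlinarith
    have h5 : (4 : ℝ) ^ p ≤ N := le_of_mul_le_mul_left (h4.trans key) (by positivity)
    calc (2 : ℝ) ^ y ≤ 2 ^ ((2 * p : ℕ) : ℝ) :=
          Real.rpow_le_rpow_of_exponent_le (by norm_num) hyp
      _ = 4 ^ p := by rw [Real.rpow_natCast, pow_mul]; norm_num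
      _ ≤ N := h5

/-- Exponential lower bound for 2-query locally decodable codes: there is a universal
constant `c > 0` such that any code `C : {±1}^n → {±1}^N` admitting, for each `i ∈ [n]`,
a matching of at least `δεN/4` disjoint pairs whose parities predict `x_i` with bias at
least `ε/4`, must have `N ≥ 2^{c δ² ε⁴ n}`. -/
theorem two_query_ldc_exponential_lower_bound :
    ∃ c : ℝ, c > 0 ∧
      ∀ n N : ℕ, 1 ≤ n → 1 ≤ N →
      ∀ δ ε : ℝ, 0 < δ → δ ≤ 1 → 0 < ε → ε ≤ 1 →
      ∀ C : (Fin n → Bool) → (Fin N → Bool),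
        (∀ i : Fin n, ∃ M : Finset (Finset (Fin N)),
          (∀ Q ∈ M, Q.card = 2) ∧
          (∀ Q ∈ M, ∀ Q' ∈ M, Q ≠ Q' → Disjoint Q Q') ∧
          (M.card : ℝ) ≥ δ * ε * N / 4 ∧
          (∀ Q ∈ M, ∃ a : ℝ, (a = 1 ∨ a = -1) ∧
            (2 ^ n : ℝ)⁻¹ * ∑ x : Fin n → Bool,
                a * pmOne (x i) * ∏ j ∈ Q, pmOne (C x j) ≥ ε / 4)) →
        (N : ℝ) ≥ 2 ^ (c * δ ^ 2 * ε ^ 4 * n) := by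
  refine ⟨1 / 512, by norm_num, ?_⟩
  intro n N hn hN δ ε hδ _ hε _ C hC
  choose M h2 hM hcard hbias using hC
  choose! a ha hb using hbias
  have hN0 : (0 : ℝ) < N := by exact_mod_cast hN
  have hN2 : 2 ≤ N := by
    have hpos : (0 : ℝ) < (M ⟨0, hn⟩).card := lt_of_lt_of_le (by positivity) (hcard ⟨0, hn⟩)
    obtain ⟨Q, hQ⟩ := Finset.card_pos.mp (by exact_mod_cast hpos : 0 < (M ⟨0, hn⟩).card)
    simpa [h2 _ Q hQ] using Finset.card_le_univ Q
  choose d hd hd1 using fun i => pairMatrix_mul_self (h2 i) (hM i) (ha i)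
  let A : Fin n → Matrix (Fin N) (Fin N) ℝ := fun i => pairMatrix (M i) (a i)
  let v : (Fin n → Bool) → Fin N → ℝ := fun x j => pmOne (C x j)
  have hv (x) : v x ⬝ᵥ v x = Fintype.card (Fin N) := by
    simp [v, dotProduct, pmOne_mul_self]
  have hlow : n * N * (δ * ε ^ 2 / 8) ≤
      ((2 : ℝ) ^ n)⁻¹ * ∑ x, v x ⬝ᵥ signSum A x *ᵥ v x := by
    have hrw : ((2 : ℝ) ^ n)⁻¹ * ∑ x, v x ⬝ᵥ signSum A x *ᵥ v x =
        ∑ i, 2 * ∑ Q ∈ M i, (2 ^ n : ℝ)⁻¹ * ∑ x : Fin n → Bool,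
          a i Q * pmOne (x i) * ∏ j ∈ Q, pmOne (C x j) := by
      have hx (x) : v x ⬝ᵥ signSum A x *ᵥ v x =
          ∑ i, 2 * ∑ Q ∈ M i, a i Q * pmOne (x i) * ∏ j ∈ Q, pmOne (C x j) := by
        rw [signSum, sum_mulVec, dotProduct_sum]
        refine Finset.sum_congr rfl fun i _ => ?_
        rw [smul_mulVec, dotProduct_smul, dotProduct_pairMatrix_mulVec (h2 i), smul_eq_mul,
          mul_left_comm, Finset.mul_sum]
        congr 1
        exact Finset.sum_congr rfl fun Q _ => by ring
      simp only [hx]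
      rw [Finset.sum_comm, Finset.mul_sum]
      refine Finset.sum_congr rfl fun i _ => ?_
      rw [← Finset.mul_sum, Finset.sum_comm, mul_left_comm, Finset.mul_sum]
    rw [hrw]
    calc n * N * (δ * ε ^ 2 / 8) = ∑ _i : Fin n, 2 * ((δ * ε * N / 4) * (ε / 4)) := by
          simp only [Finset.sum_const, Finset.card_univ, Fintype.card_fin, nsmul_eq_mul]
          ring
      _ ≤ _ := by
        refine Finset.sum_le_sum fun i _ => mul_le_mul_of_nonneg_left ?_ (by norm_num)
        calc (δ * ε * N / 4) * (ε / 4) ≤ (M i).card * (ε / 4) :=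
              mul_le_mul_of_nonneg_right (hcard i) (by positivity)
          _ ≤ _ := by
            rw [← nsmul_eq_mul]
            exact Finset.card_nsmul_le_sum _ _ _ fun Q hQ => hb i Q hQ
  have hmain := two_rpow_le_of_pow_le hn hN2 (t := δ * ε ^ 2 / 8) fun p hp => by
    refine (pow_le_pow_left₀ (by positivity) hlow _).trans ?_
    simpa using mean_dotProduct_signSum_pow_le (fun i => pairMatrix_isSymm (M i) (a i)) hd hd1
      v hv hp
  refine le_trans (le_of_eq ?_) hmain
  congr 1
  ring
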